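/- With the Calderón–Zygmund decomposition and the truncated kernels as in the context, for every η > 0 and every w ∈ {0,1/2}^d there is a constant C' (depending only on d, η and the constants C, c₁, c₂) such that Σ_{s≥200} Σ_{K∈𝔇^w} ‖T_{K,1} b_{k−s}‖_{L¹(ℝ^d)} ≤ C'·C_Ω·‖f‖_{L¹(ℝ^d)}, where for each K the integer k = k(K) is given by l(K) = 2^k. -/

import Mathlib

open MeasureTheory Metric Set FourierTransform
open scoped ENNReal RealInnerProductSpace

noncomputable section

abbrev Rd (d : ℕ) : Type := EuclideanSpace ℝ (Fin d)

/-- Surface measure on the unit sphere `S^{d-1}`. -/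
def sphereMeasure (d : ℕ) : Measure (sphere (0 : Rd d) 1) :=
  (volume : Measure (Rd d)).toSphere

/-- Integral over the sphere of a function defined on `ℝ^d`. -/
def sphInt (d : ℕ) (g : Rd d → ℝ) : ℝ :=
  ∫ θ : sphere (0 : Rd d) 1, g (θ : Rd d) ∂(sphereMeasure d)

/-- `‖Ω‖₁`, the `L¹(S^{d-1})` norm of `Ω`. -/
def omegaL1 (d : ℕ) (Ω : Rd d → ℝ) : ℝ := sphInt d (fun x => |Ω x|)

/-- `‖Ω‖_{LlogL(S^{d-1})}`. -/
def omegaLlogL (d : ℕ) (Ω : Rd d → ℝ) : ℝ :=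
  sphInt d (fun x => |Ω x| * Real.log (2 + |Ω x|))

/-- The constant `C_Ω`. -/
def constCOmega (d : ℕ) (Ω : Rd d → ℝ) : ℝ :=
  omegaLlogL d Ω +
    sphInt d (fun x => |Ω x| * (1 + max (Real.log (|Ω x| / omegaL1 d Ω)) 0))

/-- `Ω` is homogeneous of degree zero on `ℝ^d ∖ {0}`. -/
def Homogeneous0 (d : ℕ) (Ω : Rd d → ℝ) : Prop :=
  ∀ x : Rd d, x ≠ 0 → ∀ r : ℝ, 0 < r → Ω (r • x) = Ω x

/-- The hypotheses on `Ω`: homogeneity of degree `0`, integrability on the sphere,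
the cancellation condition, and `Ω ∈ L log L(S^{d-1})`. -/
def OmegaHyp (d : ℕ) (Ω : Rd d → ℝ) : Prop :=
  Homogeneous0 d Ω ∧
  Integrable (fun θ : sphere (0 : Rd d) 1 => Ω (θ : Rd d)) (sphereMeasure d) ∧
  (∫ θ : sphere (0 : Rd d) 1, Ω (θ : Rd d) ∂(sphereMeasure d)) = 0 ∧
  Integrable (fun θ : sphere (0 : Rd d) 1 => |Ω (θ : Rd d)| * Real.log (2 + |Ω (θ : Rd d)|))
    (sphereMeasure d)

/-- `φ` is smooth, supported in the annulus `{2^{-4} < |x| < 2^{-2}}` and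
satisfies the partition of unity condition `Σ_j φ(2^{-j} x) = 1` for `x ≠ 0`. -/
def AdmissiblePhi (d : ℕ) (φ : Rd d → ℝ) : Prop :=
  ContDiff ℝ (⊤ : ℕ∞) φ ∧
  tsupport φ ⊆ {x : Rd d | (2:ℝ) ^ (-4 : ℤ) < ‖x‖ ∧ ‖x‖ < (2:ℝ) ^ (-2 : ℤ)} ∧
  ∀ x : Rd d, x ≠ 0 → HasSum (fun j : ℤ => φ ((2:ℝ) ^ (-j) • x)) 1

/-- The kernel `𝒦_j(x) = φ(2^{-j}x) Ω(x) |x|^{-d}`. -/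
def Kker (d : ℕ) (φ Om : Rd d → ℝ) (j : ℤ) (x : Rd d) : ℝ :=
  φ ((2:ℝ) ^ (-j) • x) * Om x * ‖x‖ ^ (-(d : ℤ))

/-- The dyadic operator `T_j f = 𝒦_j * f`. -/
def Tj (d : ℕ) (φ Om : Rd d → ℝ) (j : ℤ) (f : Rd d → ℝ) (x : Rd d) : ℝ :=
  ∫ y, Kker d φ Om j (x - y) * f y

/-- The maximal dyadic truncated operator `T_* f(x) = sup_l |Σ_{j ≥ l} T_j f(x)|`. -/
def TStar (d : ℕ) (φ Om f : Rd d → ℝ) (x : Rd d) : ℝ≥0∞ :=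
  ⨆ l : ℤ, ENNReal.ofReal |∑' j : {j : ℤ // l ≤ j}, Tj d φ Om (j : ℤ) f x|

/-- The dyadic cube `2^k w + ∏_i [m_i 2^k, (m_i+1) 2^k)` in the shifted grid `𝔇^w`. -/
def dcube (d : ℕ) (w : Fin d → ℝ) (k : ℤ) (m : Fin d → ℤ) : Set (Rd d) :=
  {x | ∀ i : Fin d, (2:ℝ) ^ k * (w i + m i) ≤ x i ∧ x i < (2:ℝ) ^ k * (w i + m i + 1)}

/-- The concentric cube `½K` of half the sidelength. -/
def dhalf (d : ℕ) (w : Fin d → ℝ) (k : ℤ) (m : Fin d → ℤ) : Set (Rd d) :=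
  {x | ∀ i : Fin d,
    (2:ℝ) ^ k * (w i + m i + 1/4) ≤ x i ∧ x i < (2:ℝ) ^ k * (w i + m i + 3/4)}

/-- `w ∈ {0, 1/2}^d`. -/
def GridShift (d : ℕ) (w : Fin d → ℝ) : Prop := ∀ i, w i = 0 ∨ w i = 1/2

/-- The Calderón–Zygmund decomposition data at level `λ/C_Ω`: a countable collection
`Qset` of pairwise disjoint standard dyadic cubes and bad functions `b_Q` with
`supp b_Q ⊆ Q`, `∫ b_Q = 0`, `‖b_Q‖₁ ≤ C⟨f⟩_Q |Q|` and `⟨f⟩_Q ≈ λ/C_Ω`. -/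
structure CZData (d : ℕ) (COm Cc c₁ c₂ : ℝ) (f : Rd d → ℝ) (lam : ℝ)
    (Qset : Set (ℤ × (Fin d → ℤ))) (b : ℤ × (Fin d → ℤ) → Rd d → ℝ) : Prop where
  pairwise_disjoint : Qset.Pairwise fun q q' =>
    Disjoint (dcube d 0 q.1 q.2) (dcube d 0 q'.1 q'.2)
  support_subset : ∀ q ∈ Qset, Function.support (b q) ⊆ dcube d 0 q.1 q.2
  integrable : ∀ q ∈ Qset, Integrable (b q)
  integral_zero : ∀ q ∈ Qset, (∫ x, b q x) = 0
  l1_bound : ∀ q ∈ Qset, (∫ x, |b q x|) ≤ Cc * ∫ x in dcube d 0 q.1 q.2, |f x|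
  avg_lower : ∀ q ∈ Qset, c₁ * lam / COm ≤
    (∫ x in dcube d 0 q.1 q.2, |f x|) / (volume (dcube d 0 q.1 q.2)).toReal
  avg_upper : ∀ q ∈ Qset,
    (∫ x in dcube d 0 q.1 q.2, |f x|) / (volume (dcube d 0 q.1 q.2)).toReal ≤ c₂ * lam / COm

/-- `b_m = Σ_{Q ∈ 𝒬, l(Q) = 2^m} b_Q`. -/
def bsum (d : ℕ) (Qset : Set (ℤ × (Fin d → ℤ))) (b : ℤ × (Fin d → ℤ) → Rd d → ℝ)
    (m : ℤ) (x : Rd d) : ℝ :=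
  ∑' mv : Fin d → ℤ, Set.indicator Qset (fun q => b q x) (m, mv)

/-- `Ω₁ = Ω·χ_{{|Ω| ≥ 2^{ηs}‖Ω‖₁}}`. -/
def Omega1 (d : ℕ) (Ω : Rd d → ℝ) (η : ℝ) (s : ℕ) (x : Rd d) : ℝ :=
  if (2:ℝ) ^ (η * s) * omegaL1 d Ω ≤ |Ω x| then Ω x else 0

/-- `Ω₂ = Ω·χ_{{|Ω| < 2^{ηs}‖Ω‖₁}}`. -/
def Omega2 (d : ℕ) (Ω : Rd d → ℝ) (η : ℝ) (s : ℕ) (x : Rd d) : ℝ :=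
  if |Ω x| < (2:ℝ) ^ (η * s) * omegaL1 d Ω then Ω x else 0

/-- `T_K g = 𝒦_k * (g·χ_{½K})`, for `K ∈ 𝔇^w` with `l(K) = 2^k` given by `(k, m)`,
where the kernel is built from the function `Om`. -/
def TKop (d : ℕ) (φ Om : Rd d → ℝ) (w : Fin d → ℝ) (k : ℤ) (m : Fin d → ℤ)
    (g : Rd d → ℝ) (x : Rd d) : ℝ :=
  ∫ y, Kker d φ Om k (x - y) * Set.indicator (dhalf d w k m) g y

lemma measurableSet_dcube (d : ℕ) (w : Fin d → ℝ) (k : ℤ) (m : Fin d → ℤ) :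
    MeasurableSet (dcube d w k m) := by
  simp only [dcube, ofPred_forall]
  exact MeasurableSet.iInter fun i => by measurability

lemma measurableSet_dhalf (d : ℕ) (w : Fin d → ℝ) (k : ℤ) (m : Fin d → ℤ) :
    MeasurableSet (dhalf d w k m) := by
  simp only [dhalf, ofPred_forall]
  exact MeasurableSet.iInter fun i => by measurability

/-- At a fixed scale, the half cubes of a shifted grid are pairwise disjoint. -/
lemma pairwise_disjoint_dhalf (d : ℕ) (w : Fin d → ℝ) (k : ℤ) :
    Pairwise (Function.onFun Disjoint (dhalf d w k)) := by
  intro m m' hne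
  rw [Function.onFun, Set.disjoint_left]
  intro x hx hx'
  refine hne (funext fun i => ?_)
  have h2 : (0 : ℝ) < 2 ^ k := by positivity
  have h1 := lt_of_mul_lt_mul_left ((hx i).1.trans_lt (hx' i).2) h2.le
  have h3 := lt_of_mul_lt_mul_left ((hx' i).1.trans_lt (hx i).2) h2.le
  have h4 : (m i : ℝ) < m' i + 1 := by linarith
  have h5 : (m' i : ℝ) < m i + 1 := by linarith
  norm_cast at h4 h5
  omega

lemma ofReal_integral_abs_le_lintegral_enorm {α : Type*} [MeasurableSpace α] {μ : Measure α}
    (g : α → ℝ) : ENNReal.ofReal (∫ x, |g x| ∂μ) ≤ ∫⁻ x, ‖g x‖ₑ ∂μ := by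
  have h := enorm_integral_le_lintegral_enorm (μ := μ) (fun x => |g x|)
  rw [Real.enorm_of_nonneg (integral_nonneg fun x => abs_nonneg _)] at h
  simpa using h

lemma ofReal_integral_abs {α : Type*} [MeasurableSpace α] {μ : Measure α}
    {g : α → ℝ} (hg : Integrable g μ) :
    ENNReal.ofReal (∫ x, |g x| ∂μ) = ∫⁻ x, ‖g x‖ₑ ∂μ := by
  simpa using ofReal_integral_norm_eq_lintegral_enorm hg

lemma Homogeneous0.apply_homeomorphUnitSphereProd {d : ℕ} {Om : Rd d → ℝ}
    (h : Homogeneous0 d Om) (y : ({0}ᶜ : Set (Rd d))) :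
    Om ((homeomorphUnitSphereProd (Rd d) y).1 : Rd d) = Om y := by
  have hy : (y : Rd d) ≠ 0 := y.2
  rw [homeomorphUnitSphereProd_apply_fst_coe]
  exact h _ hy _ (by positivity)

lemma nontrivial_Rd {d : ℕ} (hd : 2 ≤ d) : Nontrivial (Rd d) :=
  Module.nontrivial_of_finrank_pos (R := ℝ) (by simp only [finrank_euclideanSpace_fin]; omega)

/-- A degree-zero homogeneous function which is a.e. measurable on the sphere is a.e. measurable
on the whole space. -/
lemma Homogeneous0.aemeasurable {d : ℕ} (hd : 2 ≤ d) {Om : Rd d → ℝ} (h : Homogeneous0 d Om)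
    (hm : AEMeasurable (fun θ : sphere (0 : Rd d) 1 => Om θ) (sphereMeasure d)) :
    AEMeasurable Om volume := by
  have := nontrivial_Rd hd
  rw [← restrict_compl_singleton (μ := volume) (0 : Rd d),
    ← map_comap_subtype_coe (measurableSet_singleton _).compl,
    (MeasurableEmbedding.subtype_coe (measurableSet_singleton _).compl).aemeasurable_map_iff]
  have hmp := (volume : Measure (Rd d)).measurePreserving_homeomorphUnitSphereProd
  have h1 := (hm.comp_quasiMeasurePreserving
    (Measure.quasiMeasurePreserving_fst (ν := Measure.volumeIoiPow
      (Module.finrank ℝ (Rd d) - 1)))).comp_quasiMeasurePreserving hmp.quasiMeasurePreserving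
  refine h1.congr (Filter.Eventually.of_forall fun y => ?_)
  exact h.apply_homeomorphUnitSphereProd y

lemma Homogeneous0.omega1 {d : ℕ} {Ω : Rd d → ℝ} (h : Homogeneous0 d Ω) (η : ℝ) (s : ℕ) :
    Homogeneous0 d (Omega1 d Ω η s) := by
  intro x hx r hr
  simp only [Omega1, h x hx r hr]

lemma aemeasurable_omega1 {d : ℕ} {Ω : Rd d → ℝ} (η : ℝ) (s : ℕ)
    (hm : AEMeasurable (fun θ : sphere (0 : Rd d) 1 => Ω θ) (sphereMeasure d)) :
    AEMeasurable (fun θ : sphere (0 : Rd d) 1 => Omega1 d Ω η s θ) (sphereMeasure d) := by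
  have h : Measurable fun t : ℝ => if (2:ℝ) ^ (η * s) * omegaL1 d Ω ≤ |t| then t else 0 :=
    Measurable.ite (measurableSet_le measurable_const (by fun_prop)) measurable_id
      measurable_const
  exact h.comp_aemeasurable hm

lemma aemeasurable_Kker {d : ℕ} {φ Om : Rd d → ℝ} (hφ : Continuous φ)
    (hm : AEMeasurable Om volume) (k : ℤ) : AEMeasurable (Kker d φ Om k) volume := by
  have h1 : Measurable fun x : Rd d => φ ((2:ℝ) ^ (-k) • x) :=
    (hφ.comp (continuous_const_smul _)).measurable
  have h2 : Measurable fun x : Rd d => ‖x‖ ^ (-(d : ℤ)) := by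
    simp only [zpow_neg, zpow_natCast]
    fun_prop
  exact (h1.aemeasurable.mul hm).mul h2.aemeasurable

/-- The `L¹` norm of the truncated kernel is controlled by the `L¹(S^{d-1})` norm of its angular
part, uniformly in the scale. -/
lemma lintegral_enorm_Kker_le {d : ℕ} (hd : 2 ≤ d) {φ Om : Rd d → ℝ} {M : ℝ} (hM : 0 ≤ M)
    (hφM : ∀ x, |φ x| ≤ M)
    (hφ : tsupport φ ⊆ {x : Rd d | (2:ℝ) ^ (-4 : ℤ) < ‖x‖ ∧ ‖x‖ < (2:ℝ) ^ (-2 : ℤ)})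
    (h : Homogeneous0 d Om)
    (hm : AEMeasurable (fun θ : sphere (0 : Rd d) 1 => Om θ) (sphereMeasure d)) (k : ℤ) :
    ∫⁻ x, ‖Kker d φ Om k x‖ₑ ≤
      ENNReal.ofReal (M * 4 ^ d) * ∫⁻ θ : sphere (0 : Rd d) 1, ‖Om θ‖ₑ ∂(sphereMeasure d) := by
  have h2 : (0 : ℝ) < 2 := two_pos
  have hmp := (volume : Measure (Rd d)).measurePreserving_homeomorphUnitSphereProd
  set R : Ioi (0 : ℝ) := ⟨2 ^ (k - 2), by simp only [mem_Ioi]; positivity⟩ with hR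
  set A : ℝ := M * ((2 : ℝ) ^ (k - 4)) ^ (-(d : ℤ)) with hA
  set u : Ioi (0 : ℝ) → ℝ≥0∞ := (Iio R).indicator fun _ => ENNReal.ofReal A with hu
  set G : sphere (0 : Rd d) 1 × Ioi (0 : ℝ) → ℝ≥0∞ := fun p => ‖Om p.1‖ₑ * u p.2 with hG
  have hpt : ∀ y : ({0}ᶜ : Set (Rd d)),
      ‖Kker d φ Om k y‖ₑ ≤ G (homeomorphUnitSphereProd (Rd d) y) := by
    intro y
    have hy : 0 < ‖(y : Rd d)‖ := norm_pos_iff.2 y.2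
    by_cases hz : φ ((2:ℝ) ^ (-k) • (y : Rd d)) = 0
    · rw [Kker, hz]
      simp
    have hmem := hφ (subset_tsupport φ hz)
    simp only [mem_ofPred_eq, norm_smul, norm_zpow, Real.norm_ofNat] at hmem
    have hk : (2:ℝ) ^ k * 2 ^ (-k) = 1 := by rw [← zpow_add₀ h2.ne']; simp
    have hkp : (0:ℝ) < 2 ^ k := by positivity
    have e4 : (2:ℝ) ^ (k - 4) = 2 ^ k * 2 ^ (-4 : ℤ) := by
      rw [← zpow_add₀ h2.ne']; rfl
    have e2 : (2:ℝ) ^ (k - 2) = 2 ^ k * 2 ^ (-2 : ℤ) := by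
      rw [← zpow_add₀ h2.ne']; rfl
    have hlo : (2:ℝ) ^ (k - 4) < ‖(y : Rd d)‖ := by
      have := mul_lt_mul_of_pos_left hmem.1 hkp
      rwa [← mul_assoc, hk, one_mul, ← e4] at this
    have hhi : ‖(y : Rd d)‖ < (2:ℝ) ^ (k - 2) := by
      have := mul_lt_mul_of_pos_left hmem.2 hkp
      rwa [← mul_assoc, hk, one_mul, ← e2] at this
    have hin : (homeomorphUnitSphereProd (Rd d) y).2 ∈ Iio R := by
      rw [mem_Iio, ← Subtype.coe_lt_coe, homeomorphUnitSphereProd_apply_snd_coe]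
      exact hhi
    simp only [hG, hu, indicator_of_mem hin, h.apply_homeomorphUnitSphereProd y]
    rw [Real.enorm_eq_ofReal_abs, Real.enorm_eq_ofReal_abs,
      ← ENNReal.ofReal_mul (abs_nonneg _)]
    refine ENNReal.ofReal_le_ofReal ?_
    have hpow : ‖(y : Rd d)‖ ^ (-(d : ℤ)) ≤ ((2 : ℝ) ^ (k - 4)) ^ (-(d : ℤ)) := by
      simp only [zpow_neg, zpow_natCast]
      gcongr
    rw [Kker, abs_mul, abs_mul, abs_of_nonneg (zpow_nonneg (norm_nonneg _) _), hA]
    calc |φ ((2:ℝ) ^ (-k) • (y : Rd d))| * |Om y| * ‖(y : Rd d)‖ ^ (-(d : ℤ))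
        ≤ M * |Om y| * ((2 : ℝ) ^ (k - 4)) ^ (-(d : ℤ)) := by
          gcongr
          exact hφM _
      _ = |Om y| * (M * ((2 : ℝ) ^ (k - 4)) ^ (-(d : ℤ))) := by ring
  have hdim : Module.finrank ℝ (Rd d) - 1 + 1 = d := by
    simp only [finrank_euclideanSpace, Fintype.card_fin]; omega
  calc ∫⁻ x, ‖Kker d φ Om k x‖ₑ
      = ∫⁻ y : ({0}ᶜ : Set (Rd d)), ‖Kker d φ Om k y‖ₑ ∂(Measure.comap Subtype.val volume) := by
        have := nontrivial_Rd hd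
        rw [lintegral_subtype_comap (measurableSet_singleton _).compl
          (fun x => ‖Kker d φ Om k x‖ₑ), restrict_compl_singleton]
    _ ≤ ∫⁻ y : ({0}ᶜ : Set (Rd d)), G (homeomorphUnitSphereProd (Rd d) y)
          ∂(Measure.comap Subtype.val volume) := lintegral_mono hpt
    _ = ∫⁻ p, G p ∂((sphereMeasure d).prod
          (Measure.volumeIoiPow (Module.finrank ℝ (Rd d) - 1))) :=
        hmp.lintegral_comp_emb (Homeomorph.measurableEmbedding _) G
    _ = (∫⁻ θ : sphere (0 : Rd d) 1, ‖Om θ‖ₑ ∂(sphereMeasure d)) *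
          ∫⁻ r, u r ∂(Measure.volumeIoiPow (Module.finrank ℝ (Rd d) - 1)) := by
        have : SFinite (sphereMeasure d) := by unfold sphereMeasure; infer_instance
        exact lintegral_prod_mul hm.enorm
          ((measurable_const.indicator measurableSet_Iio).aemeasurable)
    _ ≤ (∫⁻ θ : sphere (0 : Rd d) 1, ‖Om θ‖ₑ ∂(sphereMeasure d)) *
          ENNReal.ofReal (M * 4 ^ d) := by
        gcongr
        rw [hu, lintegral_indicator_const measurableSet_Iio, Measure.volumeIoiPow_apply_Iio,
          hdim, ← ENNReal.ofReal_mul (by positivity)]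
        refine ENNReal.ofReal_le_ofReal ?_
        have hd1 : (1 : ℝ) ≤ ((Module.finrank ℝ (Rd d) - 1 : ℕ) : ℝ) + 1 := by
          linarith [Nat.cast_nonneg (α := ℝ) (Module.finrank ℝ (Rd d) - 1)]
        have hq : ((2 : ℝ) ^ (k - 4)) ^ (-(d : ℤ)) * ((2 : ℝ) ^ (k - 2)) ^ d = 4 ^ d := by
          rw [zpow_neg, zpow_natCast, ← inv_pow, ← mul_pow, ← zpow_neg, ← zpow_add₀ h2.ne']
          congr 1
          rw [show -(k - 4) + (k - 2) = 2 by ring]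
          norm_num
        calc A * (((2 : ℝ) ^ (k - 2)) ^ d / (((Module.finrank ℝ (Rd d) - 1 : ℕ) : ℝ) + 1))
            ≤ A * ((2 : ℝ) ^ (k - 2)) ^ d := by
              gcongr
              exact div_le_self (by positivity) hd1
          _ = M * 4 ^ d := by rw [hA, mul_assoc, hq]
    _ = _ := mul_comm _ _

/-- Young's inequality for the localized operator `T_K`, with `g` dominated by `B`. -/
lemma lintegral_enorm_TKop_le {d : ℕ} {φ Om : Rd d → ℝ} {k : ℤ}
    (hK : AEMeasurable (Kker d φ Om k) volume) {g : Rd d → ℝ} {B : Rd d → ℝ≥0∞}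
    (hB : AEMeasurable B volume) (hg : ∀ x, ‖g x‖ₑ ≤ B x) (w : Fin d → ℝ) (m : Fin d → ℤ) :
    ∫⁻ x, ‖TKop d φ Om w k m g x‖ₑ ≤
      (∫⁻ x, ‖Kker d φ Om k x‖ₑ) * ∫⁻ y in dhalf d w k m, B y := by
  set B' : Rd d → ℝ≥0∞ := (dhalf d w k m).indicator B with hB'
  have hB'm : AEMeasurable B' volume := hB.indicator (measurableSet_dhalf d w k m)
  have hpt : ∀ x, ‖TKop d φ Om w k m g x‖ₑ ≤ ∫⁻ y, ‖Kker d φ Om k (x - y)‖ₑ * B' y := by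
    intro x
    refine (enorm_integral_le_lintegral_enorm _).trans (lintegral_mono fun y => ?_)
    rw [enorm_mul]
    gcongr
    rw [enorm_indicator_eq_indicator_enorm]
    exact indicator_le_indicator (hg y)
  have hmeas : AEMeasurable
      (Function.uncurry fun x y => ‖Kker d φ Om k (x - y)‖ₑ * B' y)
      ((volume : Measure (Rd d)).prod volume) :=
    (hK.enorm.comp_quasiMeasurePreserving
      (quasiMeasurePreserving_sub_of_right_invariant volume volume)).mul
      (hB'm.comp_quasiMeasurePreserving Measure.quasiMeasurePreserving_snd)
  calc ∫⁻ x, ‖TKop d φ Om w k m g x‖ₑ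
      ≤ ∫⁻ x, ∫⁻ y, ‖Kker d φ Om k (x - y)‖ₑ * B' y := lintegral_mono hpt
    _ = ∫⁻ y, ∫⁻ x, ‖Kker d φ Om k (x - y)‖ₑ * B' y := lintegral_lintegral_swap hmeas
    _ = ∫⁻ y, (∫⁻ x, ‖Kker d φ Om k x‖ₑ) * B' y := by
        refine lintegral_congr fun y => ?_
        have hKy : AEMeasurable (fun x => ‖Kker d φ Om k (x - y)‖ₑ) volume :=
          hK.enorm.comp_quasiMeasurePreserving
            (measurePreserving_sub_right volume y).quasiMeasurePreserving
        rw [lintegral_mul_const'' _ hKy,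
          lintegral_sub_right_eq_self (fun x => ‖Kker d φ Om k x‖ₑ) y]
    _ = (∫⁻ x, ‖Kker d φ Om k x‖ₑ) * ∫⁻ y, B' y := lintegral_const_mul'' _ hB'm
    _ = _ := by rw [hB', lintegral_indicator (measurableSet_dhalf d w k m)]

/-- Summing the large parts `Ω₁` over `s` costs one logarithm. -/
lemma tsum_enorm_omega1_le {d : ℕ} {Ω : Rd d → ℝ} {η : ℝ} (hη : 0 < η) {x : Rd d}
    (hx : 0 < omegaL1 d Ω ∨ Ω x = 0) :
    ∑' s : {n : ℕ // 200 ≤ n}, ‖Omega1 d Ω η s.1 x‖ₑ ≤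
      ENNReal.ofReal (1 / (η * Real.log 2) *
        (|Ω x| * (1 + max (Real.log (|Ω x| / omegaL1 d Ω)) 0))) := by
  rcases hx with hN | h0
  swap
  · simp [Omega1, h0]
  have hl : 0 < η * Real.log 2 := mul_pos hη (Real.log_pos one_lt_two)
  set t := |Ω x| / omegaL1 d Ω with ht
  set L := Real.log t / (η * Real.log 2) with hL
  have hzero : ∀ n : ℕ, n ∉ Finset.Icc 1 ⌊L⌋₊ →
      ({n : ℕ | 200 ≤ n}.indicator (fun n => ‖Omega1 d Ω η n x‖ₑ)) n = 0 := by
    intro n hn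
    by_contra hne
    have h200 : 200 ≤ n := mem_of_indicator_ne_zero hne
    rw [indicator_of_mem (show n ∈ {n : ℕ | 200 ≤ n} from h200)] at hne
    have hle : (2:ℝ) ^ (η * n) * omegaL1 d Ω ≤ |Ω x| := by
      by_contra hlt
      simp [Omega1, hlt] at hne
    have hle' : (2:ℝ) ^ (η * n) ≤ t := (le_div_iff₀ hN).2 hle
    have hlog := Real.log_le_log (by positivity) hle'
    rw [Real.log_rpow two_pos] at hlog
    refine hn (Finset.mem_Icc.2 ⟨by omega, Nat.le_floor ?_⟩)
    rw [hL, le_div_iff₀ hl]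
    linarith
  have hfloor : (⌊L⌋₊ : ℝ) ≤ 1 / (η * Real.log 2) * (1 + max (Real.log t) 0) := by
    rcases le_total 0 L with h | h
    · refine (Nat.floor_le h).trans ?_
      rw [hL, div_eq_inv_mul, one_div]
      gcongr
      linarith [le_max_left (Real.log t) 0]
    · rw [Nat.floor_of_nonpos h]
      have := le_max_right (Real.log t) 0
      simp only [Nat.cast_zero]
      positivity
  calc ∑' s : {n : ℕ // 200 ≤ n}, ‖Omega1 d Ω η s.1 x‖ₑ
      = ∑' n, ({n : ℕ | 200 ≤ n}.indicator (fun n => ‖Omega1 d Ω η n x‖ₑ)) n :=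
        tsum_subtype {n : ℕ | 200 ≤ n} (fun n => ‖Omega1 d Ω η n x‖ₑ)
    _ = ∑ n ∈ Finset.Icc 1 ⌊L⌋₊,
          ({n : ℕ | 200 ≤ n}.indicator (fun n => ‖Omega1 d Ω η n x‖ₑ)) n :=
        tsum_eq_sum hzero
    _ ≤ ∑ n ∈ Finset.Icc 1 ⌊L⌋₊, ‖Ω x‖ₑ := by
        refine Finset.sum_le_sum fun n _ => (indicator_le_self _ _ _).trans ?_
        rw [Omega1]
        split_ifs <;> simp
    _ = ENNReal.ofReal (⌊L⌋₊ * |Ω x|) := by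
        rw [Finset.sum_const, Nat.card_Icc, ENNReal.ofReal_mul (by positivity),
          ← Real.enorm_eq_ofReal_abs]
        simp
    _ ≤ _ := by
        refine ENNReal.ofReal_le_ofReal ?_
        calc (⌊L⌋₊ : ℝ) * |Ω x|
            ≤ (1 / (η * Real.log 2) * (1 + max (Real.log t) 0)) * |Ω x| := by gcongr
          _ = _ := by ring

lemma OmegaHyp.aemeasurable {d : ℕ} {Ω : Rd d → ℝ} (h : OmegaHyp d Ω) :
    AEMeasurable (fun θ : sphere (0 : Rd d) 1 => Ω θ) (sphereMeasure d) :=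
  h.2.1.aestronglyMeasurable.aemeasurable

/-- The normalized `L log L` integrand is integrable for `Ω ∈ L log L`. -/
lemma OmegaHyp.integrable_mul_one_add_posLog {d : ℕ} {Ω : Rd d → ℝ} (h : OmegaHyp d Ω) :
    Integrable (fun θ : sphere (0 : Rd d) 1 =>
      |Ω θ| * (1 + max (Real.log (|Ω θ| / omegaL1 d Ω)) 0)) (sphereMeasure d) := by
  set N := omegaL1 d Ω
  have hmeas := h.aemeasurable
  refine ((h.2.1.abs.const_mul (1 + |Real.log N|)).add h.2.2.2).mono ?_
    (Filter.Eventually.of_forall fun θ => ?_)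
  · have hf : Measurable fun t : ℝ => |t| * (1 + max (Real.log (|t| / N)) 0) := by fun_prop
    exact (hf.comp_aemeasurable hmeas).aestronglyMeasurable
  · have hlog2 : 0 ≤ Real.log (2 + |Ω θ|) :=
      Real.log_nonneg (by linarith [abs_nonneg (Ω θ)])
    have hmax : max (Real.log (|Ω θ| / N)) 0 ≤ |Real.log N| + Real.log (2 + |Ω θ|) := by
      refine max_le ?_ (by positivity)
      rcases eq_or_ne (Ω θ) 0 with h0 | h0
      · simp only [h0, abs_zero, zero_div, Real.log_zero]
        rw [h0, abs_zero] at hlog2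
        positivity
      rcases eq_or_ne N 0 with hN | hN
      · simp only [hN, div_zero, Real.log_zero, abs_zero, zero_add]
        exact hlog2
      rw [Real.log_div (abs_pos.2 h0).ne' hN]
      have h1 : Real.log |Ω θ| ≤ Real.log (2 + |Ω θ|) :=
        Real.log_le_log (abs_pos.2 h0) (by linarith)
      linarith [neg_abs_le (Real.log N)]
    have hm0 := le_max_right (Real.log (|Ω θ| / N)) 0
    rw [Real.norm_of_nonneg (by positivity), Pi.add_apply, Real.norm_of_nonneg (by positivity)]
    calc |Ω θ| * (1 + max (Real.log (|Ω θ| / N)) 0)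
        ≤ |Ω θ| * (1 + (|Real.log N| + Real.log (2 + |Ω θ|))) := by gcongr
      _ = _ := by ring

lemma omegaLlogL_nonneg (d : ℕ) (Ω : Rd d → ℝ) : 0 ≤ omegaLlogL d Ω :=
  integral_nonneg fun θ => mul_nonneg (abs_nonneg _)
    (Real.log_nonneg (by linarith [abs_nonneg (Ω θ)]))

lemma constCOmega_nonneg (d : ℕ) (Ω : Rd d → ℝ) : 0 ≤ constCOmega d Ω :=
  add_nonneg (omegaLlogL_nonneg d Ω) <| integral_nonneg fun _ => mul_nonneg (abs_nonneg _)
    (add_nonneg zero_le_one (le_max_right _ _))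

lemma tsum_lintegral_enorm_omega1_le {d : ℕ} {Ω : Rd d → ℝ} (h : OmegaHyp d Ω) {η : ℝ}
    (hη : 0 < η) :
    ∑' s : {n : ℕ // 200 ≤ n},
        ∫⁻ θ : sphere (0 : Rd d) 1, ‖Omega1 d Ω η s.1 θ‖ₑ ∂(sphereMeasure d) ≤
      ENNReal.ofReal (1 / (η * Real.log 2) * constCOmega d Ω) := by
  have hl : 0 < η * Real.log 2 := mul_pos hη (Real.log_pos one_lt_two)
  have hae : ∀ᵐ θ : sphere (0 : Rd d) 1 ∂(sphereMeasure d), 0 < omegaL1 d Ω ∨ Ω θ = 0 := by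
    have hN0 : 0 ≤ omegaL1 d Ω := integral_nonneg fun θ => abs_nonneg (Ω θ)
    rcases hN0.eq_or_lt with h0 | h0
    · have := (integral_eq_zero_iff_of_nonneg
        (fun θ : sphere (0 : Rd d) 1 => abs_nonneg (Ω θ)) h.2.1.abs).1 h0.symm
      filter_upwards [this] with θ hθ
      exact Or.inr (by simpa using hθ)
    · exact Filter.Eventually.of_forall fun _ => Or.inl h0
  have hnn : ∀ θ : sphere (0 : Rd d) 1, 0 ≤ 1 / (η * Real.log 2) *
      (|Ω θ| * (1 + max (Real.log (|Ω θ| / omegaL1 d Ω)) 0)) := fun θ =>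
    mul_nonneg (by positivity) (mul_nonneg (abs_nonneg _)
      (add_nonneg zero_le_one (le_max_right _ _)))
  calc _ = ∫⁻ θ : sphere (0 : Rd d) 1, ∑' s : {n : ℕ // 200 ≤ n}, ‖Omega1 d Ω η s.1 θ‖ₑ
        ∂(sphereMeasure d) :=
        (lintegral_tsum fun s : {n : ℕ // 200 ≤ n} =>
          (aemeasurable_omega1 η s.1 h.aemeasurable).enorm).symm
    _ ≤ ∫⁻ θ : sphere (0 : Rd d) 1, ENNReal.ofReal (1 / (η * Real.log 2) *
        (|Ω θ| * (1 + max (Real.log (|Ω θ| / omegaL1 d Ω)) 0))) ∂(sphereMeasure d) :=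
        lintegral_mono_ae (hae.mono fun θ hθ => tsum_enorm_omega1_le hη hθ)
    _ = ENNReal.ofReal (1 / (η * Real.log 2) * sphInt d fun x =>
        |Ω x| * (1 + max (Real.log (|Ω x| / omegaL1 d Ω)) 0)) := by
        rw [← ofReal_integral_eq_lintegral_ofReal
          (h.integrable_mul_one_add_posLog.const_mul _) (Filter.Eventually.of_forall hnn),
          integral_const_mul, sphInt]
    _ ≤ _ := by
        refine ENNReal.ofReal_le_ofReal (mul_le_mul_of_nonneg_left ?_ (by positivity))
        exact le_add_of_nonneg_left (omegaLlogL_nonneg d Ω)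

/-- The pointwise majorant `Σ_{l(Q) = 2^m} |b_Q|` of `|b_m|`. -/
def bsumAbs (d : ℕ) (Qset : Set (ℤ × (Fin d → ℤ))) (b : ℤ × (Fin d → ℤ) → Rd d → ℝ)
    (m : ℤ) (x : Rd d) : ℝ≥0∞ :=
  ∑' mv : Fin d → ℤ, Set.indicator Qset (fun q => ‖b q x‖ₑ) (m, mv)

lemma enorm_bsum_le (d : ℕ) (Qset : Set (ℤ × (Fin d → ℤ))) (b : ℤ × (Fin d → ℤ) → Rd d → ℝ)
    (m : ℤ) (x : Rd d) : ‖bsum d Qset b m x‖ₑ ≤ bsumAbs d Qset b m x := by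
  refine enorm_tsum_le_tsum_enorm.trans (ENNReal.tsum_le_tsum fun mv => ?_)
  rw [enorm_indicator_eq_indicator_enorm]

lemma CZData.aemeasurable_indicator {d : ℕ} {COm Cc c₁ c₂ lam : ℝ} {f : Rd d → ℝ}
    {Qset : Set (ℤ × (Fin d → ℤ))} {b : ℤ × (Fin d → ℤ) → Rd d → ℝ}
    (h : CZData d COm Cc c₁ c₂ f lam Qset b) (q : ℤ × (Fin d → ℤ)) :
    AEMeasurable (fun x => Set.indicator Qset (fun q => ‖b q x‖ₑ) q) volume := by
  by_cases hq : q ∈ Qset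
  · simpa [hq] using (h.integrable q hq).aestronglyMeasurable.aemeasurable.enorm
  · simp [hq]

lemma CZData.aemeasurable_bsumAbs {d : ℕ} {COm Cc c₁ c₂ lam : ℝ} {f : Rd d → ℝ}
    {Qset : Set (ℤ × (Fin d → ℤ))} {b : ℤ × (Fin d → ℤ) → Rd d → ℝ}
    (h : CZData d COm Cc c₁ c₂ f lam Qset b) (m : ℤ) :
    AEMeasurable (bsumAbs d Qset b m) volume :=
  AEMeasurable.tsum fun mv => h.aemeasurable_indicator (m, mv)

lemma CZData.tsum_lintegral_bsumAbs_le {d : ℕ} {COm Cc c₁ c₂ lam : ℝ} {f : Rd d → ℝ}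
    {Qset : Set (ℤ × (Fin d → ℤ))} {b : ℤ × (Fin d → ℤ) → Rd d → ℝ}
    (h : CZData d COm Cc c₁ c₂ f lam Qset b) (hC : 0 ≤ Cc) (hf : Integrable f) :
    ∑' m : ℤ, ∫⁻ x, bsumAbs d Qset b m x ≤ ENNReal.ofReal (Cc * ∫ x, |f x|) := by
  calc ∑' m : ℤ, ∫⁻ x, bsumAbs d Qset b m x
      = ∑' (m : ℤ) (mv : Fin d → ℤ),
          ∫⁻ x, Set.indicator Qset (fun q => ‖b q x‖ₑ) (m, mv) := by
        refine tsum_congr fun m => ?_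
        exact lintegral_tsum fun mv => h.aemeasurable_indicator (m, mv)
    _ = ∑' q : ℤ × (Fin d → ℤ), ∫⁻ x, Set.indicator Qset (fun q => ‖b q x‖ₑ) q :=
        (ENNReal.tsum_prod (f := fun m mv =>
          ∫⁻ x, Set.indicator Qset (fun q => ‖b q x‖ₑ) (m, mv))).symm
    _ = ∑' q, Set.indicator Qset (fun q => ∫⁻ x, ‖b q x‖ₑ) q := by
        refine tsum_congr fun q => ?_
        by_cases hq : q ∈ Qset <;> simp [hq]
    _ = ∑' q : Qset, ∫⁻ x, ‖b q x‖ₑ := (tsum_subtype Qset fun q => ∫⁻ x, ‖b q x‖ₑ).symm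
    _ ≤ ∑' q : Qset, ENNReal.ofReal Cc * ∫⁻ x in dcube d 0 q.1.1 q.1.2, ‖f x‖ₑ := by
        refine ENNReal.tsum_le_tsum fun q => ?_
        rw [← ofReal_integral_abs (h.integrable q q.2), ← ofReal_integral_abs hf.integrableOn,
          ← ENNReal.ofReal_mul hC]
        exact ENNReal.ofReal_le_ofReal (h.l1_bound q q.2)
    _ = ENNReal.ofReal Cc * ∫⁻ x in ⋃ q : Qset, dcube d 0 q.1.1 q.1.2, ‖f x‖ₑ := by
        rw [ENNReal.tsum_mul_left, lintegral_iUnion (fun q => measurableSet_dcube _ _ _ _)]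
        exact fun q q' hne => h.pairwise_disjoint q.2 q'.2 (Subtype.coe_ne_coe.2 hne)
    _ ≤ ENNReal.ofReal Cc * ∫⁻ x, ‖f x‖ₑ := by
        gcongr
        exact Measure.restrict_le_self
    _ = _ := by rw [← ofReal_integral_abs hf, ← ENNReal.ofReal_mul hC]

/-- `Σ_{s ≥ 200} Σ_{K ∈ 𝔇^w} ‖T_{K,1} b_{k-s}‖_{L¹} ≲ C_Ω ‖f‖_{L¹}`. -/
theorem TK1_l1_bound :
    ∀ d : ℕ, 2 ≤ d →
    ∀ Cc c₁ c₂ : ℝ, 0 < Cc → 0 < c₁ → 0 < c₂ →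
    ∀ η : ℝ, 0 < η →
    ∀ φ : Rd d → ℝ, AdmissiblePhi d φ →
    ∃ C' : ℝ, 0 < C' ∧
      ∀ Ω : Rd d → ℝ, OmegaHyp d Ω →
      ∀ f : Rd d → ℝ, Integrable f →
      ∀ lam : ℝ, 0 < lam →
      ∀ (Qset : Set (ℤ × (Fin d → ℤ))) (b : ℤ × (Fin d → ℤ) → Rd d → ℝ),
        CZData d (constCOmega d Ω) Cc c₁ c₂ f lam Qset b →
      ∀ w : Fin d → ℝ, GridShift d w →
        (∑' (s : {n : ℕ // 200 ≤ n}) (km : ℤ × (Fin d → ℤ)),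
            ENNReal.ofReal (∫ x : Rd d, |TKop d φ (Omega1 d Ω η s.1) w km.1 km.2
              (bsum d Qset b (km.1 - (s.1 : ℤ))) x|)) ≤
          ENNReal.ofReal (C' * constCOmega d Ω * ∫ x : Rd d, |f x|) := by
  intro d hd Cc c₁ c₂ hCc _ _ η hη φ ⟨hφs, hφt, _⟩
  have hcont : Continuous φ := hφs.continuous
  have hcomp : HasCompactSupport φ := by
    refine (isCompact_closedBall (0 : Rd d) ((2:ℝ) ^ (-2 : ℤ))).of_isClosed_subset
      (isClosed_tsupport φ) fun x hx => ?_
    rw [mem_closedBall_zero_iff]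
    exact (hφt hx).2.le
  obtain ⟨M₀, hM₀⟩ := hcomp.exists_bound_of_continuous hcont
  set M := max M₀ 1 with hMdef
  have hM : 0 < M := lt_max_of_lt_right one_pos
  have hφM : ∀ x, |φ x| ≤ M := fun x => (hM₀ x).trans (le_max_left _ _)
  have hl : 0 < η * Real.log 2 := mul_pos hη (Real.log_pos one_lt_two)
  refine ⟨M * 4 ^ d * (1 / (η * Real.log 2)) * Cc, by positivity, ?_⟩
  intro Ω hΩ f hf lam _ Qset b hCZ w _
  have hscale : ∀ (s : ℕ) (k : ℤ),
      ∑' m : Fin d → ℤ, ENNReal.ofReal (∫ x : Rd d, |TKop d φ (Omega1 d Ω η s) w k m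
        (bsum d Qset b (k - (s : ℤ))) x|) ≤
      ENNReal.ofReal (M * 4 ^ d) *
        (∫⁻ θ : sphere (0 : Rd d) 1, ‖Omega1 d Ω η s θ‖ₑ ∂(sphereMeasure d)) *
        ∫⁻ x, bsumAbs d Qset b (k - (s : ℤ)) x := by
    intro s k
    have hom := hΩ.1.omega1 η s
    have hme := aemeasurable_omega1 η s hΩ.aemeasurable
    calc _ ≤ ∑' m : Fin d → ℤ, (∫⁻ x, ‖Kker d φ (Omega1 d Ω η s) k x‖ₑ) *
          ∫⁻ y in dhalf d w k m, bsumAbs d Qset b (k - (s : ℤ)) y :=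
          ENNReal.tsum_le_tsum fun m => (ofReal_integral_abs_le_lintegral_enorm _).trans
            (lintegral_enorm_TKop_le (aemeasurable_Kker hcont (hom.aemeasurable hd hme) k)
              (hCZ.aemeasurable_bsumAbs _) (enorm_bsum_le d Qset b _) w m)
      _ = (∫⁻ x, ‖Kker d φ (Omega1 d Ω η s) k x‖ₑ) *
          ∫⁻ y in ⋃ m, dhalf d w k m, bsumAbs d Qset b (k - (s : ℤ)) y := by
          rw [ENNReal.tsum_mul_left, lintegral_iUnion (fun m => measurableSet_dhalf d w k m)
            (pairwise_disjoint_dhalf d w k)]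
      _ ≤ _ := mul_le_mul' (lintegral_enorm_Kker_le hd hM.le hφM hφt hom hme k)
          (setLIntegral_le_lintegral _ _)
  calc _ ≤ ∑' s : {n : ℕ // 200 ≤ n}, ENNReal.ofReal (M * 4 ^ d) *
        (∫⁻ θ : sphere (0 : Rd d) 1, ‖Omega1 d Ω η s.1 θ‖ₑ ∂(sphereMeasure d)) *
        ENNReal.ofReal (Cc * ∫ x, |f x|) := by
        refine ENNReal.tsum_le_tsum fun s => ?_
        rw [ENNReal.tsum_prod (f := fun k m => ENNReal.ofReal (∫ x : Rd d,
          |TKop d φ (Omega1 d Ω η s.1) w k m (bsum d Qset b (k - (s.1 : ℤ))) x|))]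
        refine (ENNReal.tsum_le_tsum fun k => hscale s.1 k).trans ?_
        rw [ENNReal.tsum_mul_left]
        gcongr
        exact ((Equiv.subRight (s.1 : ℤ)).tsum_eq
          (fun m => ∫⁻ x, bsumAbs d Qset b m x)).trans_le
          (hCZ.tsum_lintegral_bsumAbs_le hCc.le hf)
    _ = ENNReal.ofReal (M * 4 ^ d) * (∑' s : {n : ℕ // 200 ≤ n},
        ∫⁻ θ : sphere (0 : Rd d) 1, ‖Omega1 d Ω η s.1 θ‖ₑ ∂(sphereMeasure d)) *
        ENNReal.ofReal (Cc * ∫ x, |f x|) := by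
        rw [ENNReal.tsum_mul_right, ENNReal.tsum_mul_left]
    _ ≤ ENNReal.ofReal (M * 4 ^ d) *
        ENNReal.ofReal (1 / (η * Real.log 2) * constCOmega d Ω) *
        ENNReal.ofReal (Cc * ∫ x, |f x|) := by
        gcongr
        exact tsum_lintegral_enorm_omega1_le hΩ hη
    _ = _ := by
        have hCO := constCOmega_nonneg d Ω
        rw [← ENNReal.ofReal_mul (by positivity), ← ENNReal.ofReal_mul (by positivity)]
        congr 1
        ring
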